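/- Converse sampling theorem: Suppose W ⊆ V is a sampling set for PW_ω(G), i.e., there is c_ω > 0 such that ‖f‖₂ ≤ c_ω (Σ_{w∈W} |f(w)|²)^{1/2} for all f ∈ PW_ω(G). Then S = V \ W is a λ-set with λ = (1 + c_ω)/ω; that is, ‖φ‖₂ ≤ ((1 + c_ω)/ω) ‖Lφ‖₂ for all φ ∈ ℓ²(V) supported in S. -/

import Mathlib

noncomputable section

/-- `f` belongs to the Paley–Wiener space `PW_ω(G)`.  For a bounded positive
self-adjoint operator `L`, the condition `∀ n, ‖Lⁿf‖ ≤ ωⁿ‖f‖` characterizes exactly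
the range of the spectral projection `1_{[0,ω]}(L)`. -/
def memPaleyWiener {H : Type*} [NormedAddCommGroup H] [InnerProductSpace ℂ H]
    (L : H →L[ℂ] H) (ω : ℝ) (f : H) : Prop :=
  ∀ n : ℕ, ‖(L ^ n) f‖ ≤ ω ^ n * ‖f‖

/-- If `C` commutes with `L` and `‖C‖ ≤ ω`, then every vector on which `L` and `C` agree belongs to
the Paley–Wiener space of `L`. -/
theorem memPaleyWiener_of_apply_eq {H : Type*} [NormedAddCommGroup H] [InnerProductSpace ℂ H]
    {L C : H →L[ℂ] H} {ω : ℝ} (hcomm : Commute C L) (hC : ‖C‖ ≤ ω) {f : H} (hf : L f = C f) :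
    memPaleyWiener L ω f := by
  intro n
  induction n with
  | zero => simp
  | succ n ih =>
    have h : (L ^ (n + 1)) f = C ((L ^ n) f) := by
      rw [pow_succ, mul_apply_eq_comp, hf]
      exact (DFunLike.congr_fun (hcomm.pow_right n).eq f).symm
    calc ‖(L ^ (n + 1)) f‖ = ‖C ((L ^ n) f)‖ := by rw [h]
      _ ≤ ω * ‖(L ^ n) f‖ := C.le_of_opNorm_le hC _
      _ ≤ ω * (ω ^ n * ‖f‖) := mul_le_mul_of_nonneg_left ih ((norm_nonneg C).trans hC)
      _ = ω ^ (n + 1) * ‖f‖ := by ring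

/-- Every vector `φ` is within `ω⁻¹ ‖Lφ‖` of the Paley–Wiener space of a self-adjoint operator. -/
theorem exists_memPaleyWiener_norm_sub_le {H : Type*} [NormedAddCommGroup H]
    [InnerProductSpace ℂ H] [CompleteSpace H] {L : H →L[ℂ] H} (hL : IsSelfAdjoint L)
    {ω : ℝ} (hω : 0 < ω) (φ : H) :
    ∃ f, memPaleyWiener L ω f ∧ ‖φ - f‖ ≤ ω⁻¹ * ‖L φ‖ := by
  have hpos (x : ℝ) : 0 < max |x| ω := lt_max_of_lt_right hω
  let clamp : ℝ → ℝ := fun x => max (-ω) (min x ω)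
  let inv : ℝ → ℝ := fun x => x / max |x| ω ^ 2
  have hclamp : Continuous clamp := by fun_prop
  have hinv : Continuous inv :=
    continuous_id.div (by fun_prop) fun x => (pow_pos (hpos x) 2).ne'
  let C : H →L[ℂ] H := cfc clamp L
  let R : H →L[ℂ] H := cfc inv L
  have hC : ‖C‖ ≤ ω := norm_cfc_le hω.le fun x _ => by
    rw [Real.norm_eq_abs, abs_le]
    exact ⟨le_max_left _ _, max_le (by linarith) (min_le_right _ _)⟩
  have hR : ‖R‖ ≤ ω⁻¹ := norm_cfc_le (inv_nonneg.2 hω.le) fun x _ => by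
    rw [Real.norm_eq_abs, abs_div, abs_of_pos (pow_pos (hpos x) 2),
      div_le_iff₀ (pow_pos (hpos x) 2), sq, ← mul_assoc, ← div_eq_inv_mul]
    calc |x| ≤ 1 * max |x| ω := by simp
      _ ≤ max |x| ω / ω * max |x| ω := by
        gcongr
        exact (one_le_div hω).2 (le_max_right _ _)
  have hcomm : Commute C L := by
    have h := cfc_commute_cfc clamp id L
    rwa [cfc_id ℝ L] at h
  have hfactor : (L - C) * (R * L) = L - C := by
    have hsub : L - C = cfc (fun x => x - clamp x) L := by
      rw [cfc_sub (fun x => x) clamp L, cfc_id' ℝ L]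
    have hmul : R * L = cfc (fun x => inv x * x) L := by
      rw [cfc_mul inv (fun x => x) L hinv.continuousOn, cfc_id' ℝ L]
    rw [hmul, hsub, ← cfc_mul (fun x => x - clamp x) (fun x => inv x * x) L]
    refine cfc_congr fun x _ => ?_
    by_cases hx : |x| ≤ ω
    · have h := abs_le.1 hx
      simp [clamp, min_eq_left h.2, max_eq_right h.1]
    · have hx' : max |x| ω = |x| := max_eq_left (not_le.1 hx).le
      have hx0 : x ≠ 0 := by
        rintro rfl
        simp [hω.le] at hx
      simp only [inv, hx', sq_abs]
      field_simp
  let M : Submodule ℂ H := (L - C).ker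
  have hM {f : H} : f ∈ M ↔ (L - C) f = 0 := LinearMap.mem_ker
  have : CompleteSpace M := (L - C).isClosed_ker.completeSpace_coe
  refine ⟨M.starProjection φ, memPaleyWiener_of_apply_eq hcomm hC ?_, ?_⟩
  · exact sub_eq_zero.1 (hM.1 (M.starProjection_apply_mem φ))
  · have hmem : R (L φ) - φ ∈ M := by
      rw [hM, map_sub, sub_eq_zero]
      exact DFunLike.congr_fun hfactor φ
    have hproj := Submodule.starProjection_eq_self_iff.2 hmem
    have hperp : φ - M.starProjection φ = Mᗮ.starProjection (R (L φ)) := by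
      rw [M.starProjection_orthogonal_val, ← sub_eq_zero, ← sub_eq_zero.2 hproj, map_sub]
      abel
    rw [hperp]
    exact (Mᗮ.norm_starProjection_apply_le _).trans (R.le_of_opNorm_le hR _)

/-- A bounded operator on `ℓ²` with Hermitian matrix is self-adjoint. -/
theorem isSelfAdjoint_of_single_apply {V : Type*} [DecidableEq V]
    {L : lp (fun _ : V => ℂ) 2 →L[ℂ] lp (fun _ : V => ℂ) 2}
    (h : ∀ u v, starRingEnd ℂ (L (lp.single 2 u 1) v) = L (lp.single 2 v 1) u) :
    IsSelfAdjoint L := by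
  rw [ContinuousLinearMap.isSelfAdjoint_iff']
  refine lp.ext_continuousLinearMap (ENNReal.ofNat_ne_top (n := nat_lit 2)) fun v => ?_
  ext u
  have hadj := ContinuousLinearMap.adjoint_inner_right L (lp.single 2 u 1) (lp.single 2 v 1)
  rw [lp.inner_single_left, lp.inner_single_right] at hadj
  simpa [h] using hadj

/-- Converse sampling theorem: if `W ⊆ V` is a sampling set for `PW_ω(G)`, i.e.
`‖f‖₂ ≤ c_ω (Σ_{w ∈ W} |f(w)|²)^{1/2}` for all `f ∈ PW_ω(G)`, then `S = V \ W`
is a `λ`-set with `λ = (1 + c_ω)/ω`.  Here `L` is the normalized graph Laplacian. -/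
theorem sampling_set_complement_is_lambda_set
    {V : Type*} [Countable V] (G : SimpleGraph V) [DecidableRel G.Adj]
    [G.LocallyFinite] (hconn : G.Connected)
    (hdeg : ∃ D : ℕ, ∀ v : V, G.degree v ≤ D)
    (L : lp (fun _ : V => ℂ) 2 →L[ℂ] lp (fun _ : V => ℂ) 2)
    (hL : ∀ (f : lp (fun _ : V => ℂ) 2) (v : V),
      L f v = (1 / (Real.sqrt (G.degree v) : ℂ)) *
        ∑ u ∈ G.neighborFinset v,
          (f v / (Real.sqrt (G.degree v) : ℂ) - f u / (Real.sqrt (G.degree u) : ℂ)))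
    (W : Set V) (ω c : ℝ) (hω : 0 < ω) (hc : 0 < c)
    (hsamp : ∀ f : lp (fun _ : V => ℂ) 2, memPaleyWiener L ω f →
      ‖f‖ ≤ c * Real.sqrt (∑' w : W, ‖f ↑w‖ ^ 2)) :
    ∀ φ : lp (fun _ : V => ℂ) 2, (∀ v ∉ (Wᶜ : Set V), φ v = 0) →
      ‖φ‖ ≤ ((1 + c) / ω) * ‖L φ‖ := by
  classical
  intro φ hφ
  have hself : IsSelfAdjoint L := isSelfAdjoint_of_single_apply fun u v => by
    rcases eq_or_ne u v with rfl | huv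
    · rw [hL]
      simp [Pi.single_apply, apply_ite (starRingEnd ℂ)]
    · rw [hL, hL]
      by_cases hadj : G.Adj u v
      · simp [Pi.single_apply, huv, huv.symm, ite_div, hadj, hadj.symm, mul_comm]
      · simp [Pi.single_apply, huv, huv.symm, ite_div, hadj, G.adj_comm v u]
  obtain ⟨f, hf, hfφ⟩ := exists_memPaleyWiener_norm_sub_le hself hω φ
  have hrestrict : Real.sqrt (∑' w : W, ‖f ↑w‖ ^ 2) ≤ ‖φ - f‖ := by
    have hs : HasSum (fun v => ‖(φ - f) v‖ ^ 2) (‖φ - f‖ ^ 2) := by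
      simpa using lp.hasSum_norm (p := 2) (by norm_num) (φ - f)
    have hW (w : W) : ‖f ↑w‖ ^ 2 = ‖(φ - f) ↑w‖ ^ 2 := by
      simp [hφ w (not_not.2 w.2)]
    refine Real.sqrt_le_iff.2 ⟨norm_nonneg _, ?_⟩
    simp_rw [hW]
    rw [← hs.tsum_eq]
    exact hs.summable.tsum_subtype_le _ W fun _ => sq_nonneg _
  calc ‖φ‖ ≤ ‖φ - f‖ + ‖f‖ := by simpa using norm_add_le (φ - f) f
    _ ≤ ‖φ - f‖ + c * ‖φ - f‖ := by
      gcongr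
      exact (hsamp f hf).trans (by gcongr)
    _ = (1 + c) * ‖φ - f‖ := by ring
    _ ≤ (1 + c) * (ω⁻¹ * ‖L φ‖) := by gcongr
    _ = ((1 + c) / ω) * ‖L φ‖ := by ring
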